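/- Let m ≥ 3, N_1 ≥ N_2 ≥ ⋯ ≥ N_m ≥ 3, and r ≤ r_m, where r_m is defined by the recursion: r_3 := Ñ_{m−2}·⌊Ñ_{m−1}Ñ_m/(Ñ_{m−2}+Ñ_{m−1}+Ñ_m−2)⌋ with Ñ_{m−2}, Ñ_{m−1}, Ñ_m the largest integers such that Ñ_{m−2} is even, Ñ_{m−2} ≥ Ñ_{m−1} ≥ Ñ_m and N_i ≥ Ñ_i for i = m−2, m−1, m; and r_k := N_{m−k+1}·min{ r_{k−1}, ⌊N_{m−k+2}⋯N_m/(N_{m−k+1}+⋯+N_m−k+1)⌋ } for k = 4,…,m. Define h(Θ̃) := vec([[U_1, [1ᵀ;Ũ_2], …, [1ᵀ;Ũ_m]]]) for Θ̃ = (U_1, Ũ_2, …, Ũ_m) with U_1 ∈ ℝ^{N_1×r} and Ũ_i ∈ ℝ^{(N_i−1)×r} for 2 ≤ i ≤ m. Then for generic Θ̃, the Jacobian matrix J_h(Θ̃) has full column rank. -/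

import Mathlib

noncomputable section

/-- Index set of the free entries of the normalized CP parameters
`Θ̃ = (U₁, Ũ₂, …, Ũ_m)`: all entries of the factor matrices except the (fixed) first rows of
the factors `2,…,m`. -/
abbrev FreeIdx (m r : ℕ) (N : Fin m → ℕ) : Type :=
  {p : Σ i : Fin m, Fin (N i) × Fin r // (p.1 : ℕ) = 0 ∨ ((p.2.1 : ℕ) ≠ 0)}

/-- Embed the normalized parameters into full factor matrices, filling the first rows of the
factors `2,…,m` with ones. -/
def embOnes {m r : ℕ} {N : Fin m → ℕ}
    (x : FreeIdx m r N → ℝ) : (i : Fin m) → Fin (N i) → Fin r → ℝ :=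
  fun i j c => if h : (i : ℕ) = 0 ∨ ((j : ℕ) ≠ 0) then x ⟨⟨i, (j, c)⟩, h⟩ else 1

/-- Entry `(i₁,…,i_m)` of the CP tensor `[[W₁,…,W_m]]`, namely `∑_{c=1}^r ∏_k W_k(i_k,c)`. -/
def cpEntry {m r : ℕ} {N : Fin m → ℕ} (W : (i : Fin m) → Fin (N i) → Fin r → ℝ)
    (idx : (i : Fin m) → Fin (N i)) : ℝ :=
  ∑ c : Fin r, ∏ i : Fin m, W i (idx i) c

/-- The (vectorized) normalized CP parametrization
`h(Θ̃) = vec([[U₁, [1ᵀ;Ũ₂], …, [1ᵀ;Ũ_m]]])`. -/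
def cpVec {m r : ℕ} {N : Fin m → ℕ} (x : FreeIdx m r N → ℝ) :
    ((i : Fin m) → Fin (N i)) → ℝ :=
  fun idx => cpEntry (embOnes x) idx

/-- Largest even integer `≤ a`. -/
def evenTrunc (a : ℕ) : ℕ := if a % 2 = 0 then a else a - 1

/-- `r₃ = Ñ_{m−2}·⌊Ñ_{m−1}Ñ_m/(Ñ_{m−2}+Ñ_{m−1}+Ñ_m−2)⌋` where `Ñ_{m−2}, Ñ_{m−1}, Ñ_m` are the
largest integers with `Ñ_{m−2}` even, `Ñ_{m−2} ≥ Ñ_{m−1} ≥ Ñ_m` and `N_i ≥ Ñ_i`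
(`a = N_{m−2}`, `b = N_{m−1}`, `c = N_m`, assumed `a ≥ b ≥ c`). -/
def rankBound3 (a b c : ℕ) : ℕ :=
  let t1 := evenTrunc a
  let t2 := min b t1
  let t3 := min c t2
  t1 * (t2 * t3 / (t1 + t2 + t3 - 2))

/-- The recursive rank bound `r_k` of the paper, for a `1`-indexed dimension list
`N 1 ≥ N 2 ≥ ⋯ ≥ N m`:  `r₃` as above and
`r_k = N_{m−k+1}·min{ r_{k−1}, ⌊N_{m−k+2}⋯N_m/(N_{m−k+1}+⋯+N_m−k+1)⌋ }` for `4 ≤ k ≤ m`. -/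
def rankBound (N : ℕ → ℕ) (m : ℕ) : ℕ → ℕ
  | 0 => 0
  | 1 => 0
  | 2 => 0
  | 3 => rankBound3 (N (m - 2)) (N (m - 1)) (N m)
  | (k + 4) =>
      N (m - (k + 4) + 1) *
        min (rankBound N m (k + 3))
          ((∏ i ∈ Finset.Icc (m - (k + 4) + 2) m, N i) /
            ((∑ i ∈ Finset.Icc (m - (k + 4) + 1) m, N i) - (k + 4) + 1))


def PolyFun {σ : Type*} (f : (σ → ℝ) → ℝ) : Prop :=
  ∃ P : MvPolynomial σ ℝ, ∀ x, MvPolynomial.eval x P = f x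

theorem PolyFun.const {σ : Type*} (a : ℝ) : PolyFun (fun _ : σ → ℝ => a) :=
  ⟨MvPolynomial.C a, fun x => by simp⟩

theorem PolyFun.coord {σ : Type*} (j : σ) : PolyFun (fun x : σ → ℝ => x j) :=
  ⟨MvPolynomial.X j, fun x => by simp⟩

theorem PolyFun.add {σ : Type*} {f g : (σ → ℝ) → ℝ} (hf : PolyFun f) (hg : PolyFun g) :
    PolyFun (fun x => f x + g x) := by
  obtain ⟨P, hP⟩ := hf
  obtain ⟨Q, hQ⟩ := hg
  exact ⟨P + Q, fun x => by simp [hP, hQ]⟩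

theorem PolyFun.mul {σ : Type*} {f g : (σ → ℝ) → ℝ} (hf : PolyFun f) (hg : PolyFun g) :
    PolyFun (fun x => f x * g x) := by
  obtain ⟨P, hP⟩ := hf
  obtain ⟨Q, hQ⟩ := hg
  exact ⟨P * Q, fun x => by simp [hP, hQ]⟩

theorem PolyFun.sum {σ ι : Type*} (s : Finset ι) {f : ι → (σ → ℝ) → ℝ}
    (hf : ∀ i, PolyFun (f i)) : PolyFun (fun x => ∑ i ∈ s, f i x) := by
  choose P hP using hf
  exact ⟨∑ i ∈ s, P i, fun x => by simp [hP]⟩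

theorem PolyFun.prod {σ ι : Type*} (s : Finset ι) {f : ι → (σ → ℝ) → ℝ}
    (hf : ∀ i, PolyFun (f i)) : PolyFun (fun x => ∏ i ∈ s, f i x) := by
  choose P hP using hf
  exact ⟨∏ i ∈ s, P i, fun x => by simp [hP]⟩

theorem PolyFun.comp {σ τ : Type*} {f : (σ → ℝ) → ℝ} (hf : PolyFun f) (e : σ → τ) :
    PolyFun (fun x : τ → ℝ => f (fun j => x (e j))) := by
  obtain ⟨P, hP⟩ := hf
  exact ⟨MvPolynomial.rename e P, fun x => by
    rw [MvPolynomial.eval_rename, hP]; rfl⟩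

theorem inj_open {σ ι κ : Type*} [Fintype ι] [Fintype κ]
    (M : ι → κ → (σ → ℝ) → ℝ) (hM : ∀ i k, PolyFun (M i k)) (x0 : σ → ℝ)
    (h0 : ∀ a : ι → ℝ, (∀ k, ∑ i, a i * M i k x0 = 0) → a = 0) :
    ∃ P : MvPolynomial σ ℝ, MvPolynomial.eval x0 P ≠ 0 ∧
      ∀ x, MvPolynomial.eval x P ≠ 0 →
        ∀ a : ι → ℝ, (∀ k, ∑ i, a i * M i k x = 0) → a = 0 := by
  classical
  choose p hp using hM
  let G : Matrix ι ι (MvPolynomial σ ℝ) := Matrix.of fun i j => ∑ k, p i k * p j k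
  have hG : ∀ x, MvPolynomial.eval x G.det
      = (Matrix.of fun i j => ∑ k, M i k x * M j k x : Matrix ι ι ℝ).det := by
    intro x
    rw [RingHom.map_det]
    congr 1
    ext i j
    simp [G, hp]
  have key : ∀ x (a : ι → ℝ),
      (Matrix.of fun i j => ∑ k, M i k x * M j k x : Matrix ι ι ℝ).mulVec a
        = fun i => ∑ k, M i k x * ∑ j, a j * M j k x := by
    intro x a
    ext i
    simp only [Matrix.mulVec, dotProduct, Matrix.of_apply, Finset.sum_mul, Finset.mul_sum]
    rw [Finset.sum_comm]
    refine Finset.sum_congr rfl fun k _ => Finset.sum_congr rfl fun j _ => by ring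
  refine ⟨G.det, ?_, ?_⟩
  · rw [hG]
    intro hdet
    obtain ⟨a, ha, hz⟩ := Matrix.exists_mulVec_eq_zero_iff.mpr hdet
    apply ha
    apply h0
    rw [key] at hz
    have h1 : ∑ k, (∑ j, a j * M j k x0) ^ 2 = 0 := by
      have : ∑ i, a i * (∑ k, M i k x0 * ∑ j, a j * M j k x0) = 0 := by
        refine Finset.sum_eq_zero fun i _ => ?_
        have := congrFun hz i
        simp only [Pi.zero_apply] at this
        rw [this, mul_zero]
      rw [← this]
      simp only [pow_two]
      have h2 : ∀ i, a i * (∑ k, M i k x0 * ∑ j, a j * M j k x0)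
          = ∑ k, (a i * M i k x0) * ∑ j, a j * M j k x0 := by
        intro i
        rw [Finset.mul_sum]
        exact Finset.sum_congr rfl fun k _ => by ring
      simp only [h2]
      rw [Finset.sum_comm]
      refine Finset.sum_congr rfl fun k _ => ?_
      rw [Finset.sum_mul]
    intro k
    have := (Finset.sum_eq_zero_iff_of_nonneg (fun k _ => sq_nonneg _)).mp h1 k (Finset.mem_univ k)
    exact pow_eq_zero_iff (two_ne_zero) |>.mp this
  · intro x hx a ha
    rw [hG] at hx
    by_contra hne
    apply hx
    apply Matrix.exists_mulVec_eq_zero_iff.mp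
    refine ⟨a, hne, ?_⟩
    rw [key]
    ext i
    simp [ha]

theorem exists_common {σ γ : Type*} [Fintype γ] (P : γ → MvPolynomial σ ℝ)
    (hP : ∀ g, P g ≠ 0) : ∃ x, ∀ g, MvPolynomial.eval x (P g) ≠ 0 := by
  have h : ∏ g, P g ≠ 0 := Finset.prod_ne_zero_iff.mpr fun g _ => hP g
  by_contra hcon
  push Not at hcon
  apply h
  apply MvPolynomial.funext
  intro x
  obtain ⟨g, hg⟩ := hcon x
  rw [MvPolynomial.eval_prod, map_zero]
  exact Finset.prod_eq_zero (Finset.mem_univ g) hg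


def HH {p κ : Type*} (f : (p → ℝ) → κ → ℝ) (D : (p → ℝ) → (p → ℝ) →ₗ[ℝ] (κ → ℝ))
    (ν : Type*) (z : ν) (C : Type*) [Fintype C] : Prop :=
  ∃ (U : ν → C → ℝ) (y : C → p → ℝ), (∀ c, U z c = 1) ∧
    ∀ (A : ν → C → ℝ) (β : C → p → ℝ),
      (∀ i k, ∑ c, (A i c * f (y c) k + U i c * D (y c) (β c) k) = 0) → A = 0 ∧ β = 0

def GG {p κ : Type*} (f : (p → ℝ) → κ → ℝ) (D : (p → ℝ) → (p → ℝ) →ₗ[ℝ] (κ → ℝ))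
    (C : Type*) [Fintype C] : Prop :=
  ∃ (y : C → p → ℝ), ∀ (α : C → ℝ) (β : C → p → ℝ),
      (∀ k, ∑ c, (α c * f (y c) k + D (y c) (β c) k) = 0) → α = 0 ∧ β = 0

def Loc {p κ τ C : Type*} [Fintype C] (f : (p → ℝ) → κ → ℝ)
    (D : (p → ℝ) → (p → ℝ) →ₗ[ℝ] (κ → ℝ)) (U0 : τ → C → ℝ) (S : Type*) [Fintype S] : Prop :=
  ∃ (y : C → p → ℝ) (z : S → p → ℝ), ∀ (A : τ → C → ℝ) (β : C → p → ℝ) (B : τ → S → ℝ),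
    (∀ i k, ∑ c, (A i c * f (y c) k + U0 i c * D (y c) (β c) k)
      + ∑ s, B i s * f (z s) k = 0) → A = 0 ∧ β = 0 ∧ B = 0

def Cond {p κ τ C Γ : Type*} [Fintype C] [Fintype Γ] (f : (p → ℝ) → κ → ℝ)
    (D : (p → ℝ) → (p → ℝ) →ₗ[ℝ] (κ → ℝ)) (U0 : τ → C → ℝ) (g : Γ) (y : Γ × C → p → ℝ) : Prop :=
  ∀ (A : τ → Γ × C → ℝ) (β : C → p → ℝ),
    (∀ i k, ∑ x, A i x * f (y x) k + ∑ c, U0 i c * D (y (g, c)) (β c) k = 0) → A = 0 ∧ β = 0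

theorem HH_mono {p κ : Type*} {f : (p → ℝ) → κ → ℝ} {D : (p → ℝ) → (p → ℝ) →ₗ[ℝ] (κ → ℝ)}
    {ν : Type*} {z : ν} {C C' : Type*} [Fintype C] [Fintype C'] (e : C' ↪ C)
    (h : HH f D ν z C) : HH f D ν z C' := by
  obtain ⟨U, y, hU, h⟩ := h
  refine ⟨fun i c => U i (e c), fun c => y (e c), fun c => hU _, fun A β hz => ?_⟩
  have := h (fun i => Function.extend e (A i) 0) (Function.extend e β 0) ?_
  · obtain ⟨h1, h2⟩ := this
    constructor
    · ext i c
      have := congrFun (congrFun h1 i) (e c)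
      rwa [e.injective.extend_apply] at this
    · ext c : 1
      have := congrFun h2 (e c)
      rwa [e.injective.extend_apply] at this
  · intro i k
    rw [← hz i k]
    symm
    apply Fintype.sum_of_injective e e.injective
    · intro c hc
      have hc' : ¬ ∃ a, e a = c := fun ⟨a, ha⟩ => hc ⟨a, ha⟩
      simp [Function.extend_apply' _ _ _ hc']
    · intro c
      simp only [e.injective.extend_apply]

theorem loc_cond {p κ τ C Γ S : Type*} [Fintype C] [Fintype Γ] [Fintype S]
    {f : (p → ℝ) → κ → ℝ}
    {D : (p → ℝ) → (p → ℝ) →ₗ[ℝ] (κ → ℝ)} {U0 : τ → C → ℝ} (h : Loc f D U0 S) (g : Γ)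
    (e : {g' : Γ // g' ≠ g} × C ↪ S) : ∃ y : Γ × C → p → ℝ, Cond f D U0 g y := by
  classical
  obtain ⟨y, z, h⟩ := h
  let Y : Γ × C → p → ℝ := fun x => if h : x.1 = g then y x.2 else z (e (⟨x.1, h⟩, x.2))
  have hY1 : ∀ c, Y (g, c) = y c := fun c => by simp [Y]
  have hY2 : ∀ (g' : {g' : Γ // g' ≠ g}) c, Y (g', c) = z (e (g', c)) := fun g' c => by
    simp [Y, g'.2]
  refine ⟨Y, fun A β hz => ?_⟩
  have := h (fun i c => A i (g, c)) β
    (fun i => Function.extend e (fun x => A i (x.1, x.2)) 0) ?_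
  · obtain ⟨h1, h2, h3⟩ := this
    refine ⟨?_, h2⟩
    ext i ⟨g', c⟩
    by_cases hg : g' = g
    · subst hg
      exact congrFun (congrFun h1 i) c
    · have := congrFun (congrFun h3 i) (e (⟨g', hg⟩, c))
      rwa [e.injective.extend_apply] at this
  · intro i k
    rw [← hz i k, Fintype.sum_prod_type, Fintype.sum_eq_add_sum_subtype_ne _ g,
      Finset.sum_add_distrib]
    have : ∑ s, Function.extend e (fun x => A i (x.1, x.2)) 0 s * f (z s) k
        = ∑ x : {g' : Γ // g' ≠ g} × C, A i (x.1, x.2) * f (Y (x.1, x.2)) k := by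
      symm
      apply Fintype.sum_of_injective e e.injective
      · intro c hc
        have hc' : ¬ ∃ a, e a = c := fun ⟨a, ha⟩ => hc ⟨a, ha⟩
        simp [Function.extend_apply' _ _ _ hc']
      · intro c
        simp only [e.injective.extend_apply, hY2]
    rw [this, Fintype.sum_prod_type]
    simp only [hY1]
    ring

theorem cond_generic {p κ τ C Γ : Type*} [Fintype p] [Fintype κ] [Fintype τ] [Fintype C]
    [Fintype Γ]
    {f : (p → ℝ) → κ → ℝ}
    {D : (p → ℝ) → (p → ℝ) →ₗ[ℝ] (κ → ℝ)} (hf : ∀ k, PolyFun (fun y => f y k))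
    (hD : ∀ β k, PolyFun (fun y => D y β k)) {U0 : τ → C → ℝ}
    (h : ∀ g : Γ, ∃ y : Γ × C → p → ℝ, Cond f D U0 g y) :
    ∃ y : Γ × C → p → ℝ, ∀ g, Cond f D U0 g y := by
  classical
  have key : ∀ g : Γ, ∃ P : MvPolynomial ((Γ × C) × p) ℝ, P ≠ 0 ∧
      ∀ x, MvPolynomial.eval x P ≠ 0 → Cond f D U0 g (fun c j => x (c, j)) := by
    intro g
    obtain ⟨y, hy⟩ := h g
    let M : (τ × (Γ × C)) ⊕ (C × p) → τ × κ → ((Γ × C) × p → ℝ) → ℝ := fun a b x =>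
      Sum.elim (fun a => if a.1 = b.1 then f (fun j => x (a.2, j)) b.2 else 0)
        (fun a => U0 b.1 a.1 * D (fun j => x ((g, a.1), j)) (Pi.single a.2 1) b.2) a
    have hM : ∀ a b, PolyFun (M a b) := by
      rintro (a | a) b
      · by_cases hab : a.1 = b.1
        · simp only [M, Sum.elim_inl, hab, if_true]
          exact (hf b.2).comp (fun j => (a.2, j))
        · simp only [M, Sum.elim_inl, hab, if_false]
          exact PolyFun.const 0
      · simp only [M, Sum.elim_inr]
        exact (PolyFun.const _).mul ((hD _ b.2).comp (fun j => ((g, a.1), j)))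
    have hsum : ∀ x (a : (τ × (Γ × C)) ⊕ (C × p) → ℝ) b, ∑ i, a i * M i b x
        = ∑ c, a (Sum.inl (b.1, c)) * f (fun j => x (c, j)) b.2
          + ∑ c, U0 b.1 c * D (fun j => x ((g, c), j)) (fun j => a (Sum.inr (c, j))) b.2 := by
      intro x a b
      rw [Fintype.sum_sum_type]
      congr 1
      · simp only [M, Sum.elim_inl]
        rw [Fintype.sum_prod_type, Finset.sum_eq_single b.1]
        · simp
        · intro i _ hi
          simp [hi]
        · simp
      · simp only [M, Sum.elim_inr]
        rw [Fintype.sum_prod_type]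
        refine Finset.sum_congr rfl fun c _ => ?_
        have : (fun j => a (Sum.inr (c, j)))
            = ∑ j, a (Sum.inr (c, j)) • (Pi.single j 1 : p → ℝ) := by
          ext j
          simp [Finset.sum_apply, Pi.single_apply]
        rw [this, map_sum, Finset.sum_apply, Finset.mul_sum]
        refine Finset.sum_congr rfl fun j _ => ?_
        rw [map_smul]
        simp only [Pi.smul_apply, smul_eq_mul]
        ring
    obtain ⟨P, hP0, hP⟩ := inj_open M hM (fun cj => y cj.1 cj.2) (by
      intro a ha
      simp only [hsum] at ha
      obtain ⟨h1, h2⟩ := hy (fun i c => a (Sum.inl (i, c))) (fun c j => a (Sum.inr (c, j)))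
        (fun i k => ha (i, k))
      ext (⟨i, c⟩ | ⟨c, j⟩)
      · exact congrFun (congrFun h1 i) c
      · exact congrFun (congrFun h2 c) j)
    refine ⟨P, fun h => hP0 (by rw [h, map_zero]), fun x hx A β hz => ?_⟩
    have := hP x hx (Sum.elim (fun a => A a.1 a.2) (fun a => β a.1 a.2)) (by
      intro b
      rw [hsum]
      exact hz b.1 b.2)
    constructor
    · ext i c
      exact congrFun this (Sum.inl (i, c))
    · ext c j
      exact congrFun this (Sum.inr (c, j))
  choose P hP0 hP using key
  obtain ⟨x, hx⟩ := exists_common P hP0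
  exact ⟨fun c j => x (c, j), fun g => hP g x (hx g)⟩

theorem block {p κ τ C Γ : Type*} [Fintype τ] [Fintype C]
    [Fintype Γ] {f : (p → ℝ) → κ → ℝ}
    {D : (p → ℝ) → (p → ℝ) →ₗ[ℝ] (κ → ℝ)} {U0 : τ → C → ℝ} (i0 : τ) (hU0 : ∀ c, U0 i0 c = 1)
    (h : ∃ y : Γ × C → p → ℝ, ∀ g, Cond f D U0 g y)
    {ν : Type*} (g0 : Γ) (e : Γ × τ ↪ ν) :
    HH f D ν (e (g0, i0)) (Γ × C) := by
  classical
  obtain ⟨y, hy⟩ := h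
  let U : ν → Γ × C → ℝ := fun v x => if v = e (g0, i0) then 1 else
    ∑ i, if e (x.1, i) = v then U0 i x.2 else 0
  refine ⟨U, y, fun c => by simp [U], fun A β hz => ?_⟩
  have hz' : ∀ i k, ∑ x, A i x * f (y x) k + ∑ g, ∑ c, U i (g, c) * D (y (g, c)) (β (g, c)) k
      = 0 := by
    intro i k
    rw [← hz i k, Finset.sum_add_distrib, ← Fintype.sum_prod_type']
  have hU1 : ∀ g i g' c, e (g, i) ≠ e (g0, i0) →
      U (e (g, i)) (g', c) = if g' = g then U0 i c else 0 := by
    intro g i g' c hne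
    simp only [U, if_neg hne, e.injective.eq_iff, Prod.mk.injEq]
    by_cases hg : g' = g <;> simp [hg]
  have h1 : ∀ g, g ≠ g0 → (∀ i x, A (e (g, i)) x = 0) ∧ ∀ c, β (g, c) = 0 := by
    intro g hg
    obtain ⟨hA, hβ⟩ := hy g (fun i => A (e (g, i))) (fun c => β (g, c)) (by
      intro i k
      rw [← hz' (e (g, i)) k]
      congr 1
      rw [Finset.sum_eq_single g]
      · refine Finset.sum_congr rfl fun c _ => ?_
        rw [hU1 _ _ _ _ (by simp [hg]), if_pos rfl]
      · intro g' _ hg'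
        refine Finset.sum_eq_zero fun c _ => ?_
        rw [hU1 _ _ _ _ (by simp [hg]), if_neg hg', zero_mul]
      · simp)
    exact ⟨fun i x => congrFun (congrFun hA i) x, fun c => congrFun hβ c⟩
  have h2 : (∀ i x, A (e (g0, i)) x = 0) ∧ ∀ c, β (g0, c) = 0 := by
    obtain ⟨hA, hβ⟩ := hy g0 (fun i => A (e (g0, i))) (fun c => β (g0, c)) (by
      intro i k
      rw [← hz' (e (g0, i)) k]
      congr 1
      rw [Finset.sum_eq_single g0]
      · refine Finset.sum_congr rfl fun c _ => ?_
        by_cases hi : i = i0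
        · subst hi
          simp [U, hU0]
        · rw [hU1 _ _ _ _ (by simp [hi]), if_pos rfl]
      · intro g' _ hg'
        refine Finset.sum_eq_zero fun c _ => ?_
        rw [(h1 g' hg').2 c]
        simp
      · simp)
    exact ⟨fun i x => congrFun (congrFun hA i) x, fun c => congrFun hβ c⟩
  have hβ : β = 0 := by
    ext ⟨g, c⟩ : 1
    by_cases hg : g = g0
    · subst hg; exact h2.2 c
    · exact (h1 g hg).2 c
  refine ⟨?_, hβ⟩
  have hcond := hy g0
  ext v x
  obtain ⟨hA, -⟩ := hcond (fun i => if i = i0 then A v else 0) 0 (by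
    intro i k
    have := hz' v k
    simp only [hβ, Pi.zero_apply, map_zero, mul_zero, Finset.sum_const_zero, add_zero] at this ⊢
    by_cases hi : i = i0
    · simp [hi, this]
    · simp [hi])
  have := congrFun (congrFun hA i0) x
  simpa using this


theorem greedy {p κ : Type*} [Fintype κ] (f : (p → ℝ) → κ → ℝ)
    (hsep : ∀ a : κ → ℝ, (∀ y, ∑ k, a k * f y k = 0) → a = 0) (s : ℕ) :
    ∀ {ι : Type} [Fintype ι] (v : ι → κ → ℝ), LinearIndependent ℝ v →
      Fintype.card ι + s ≤ Fintype.card κ →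
      ∃ z : Fin s → p → ℝ, LinearIndependent ℝ (Sum.elim v (fun i => f (z i))) := by
  classical
  induction s with
  | zero =>
    intro ι _ v hv _
    refine ⟨fun i => i.elim0, ?_⟩
    have := hv.comp (Sum.elim id (fun i : Fin 0 => i.elim0)) (by
      rintro (a | a) (b | b) h
      · simpa using h
      · exact b.elim0
      · exact a.elim0
      · exact a.elim0)
    convert this using 1
    ext (a | a) k
    · rfl
    · exact a.elim0
  | succ s ih =>
    intro ι _ v hv hc
    have hlt : Submodule.span ℝ (Set.range v) < ⊤ := by
      rw [lt_top_iff_ne_top]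
      intro htop
      have h1 := finrank_span_eq_card hv
      rw [htop, finrank_top, Module.finrank_fintype_fun_eq_card] at h1
      omega
    have hex : ∃ y, f y ∉ Submodule.span ℝ (Set.range v) := by
      by_contra hcon
      push Not at hcon
      obtain ⟨φ, hφ, hle⟩ := Submodule.exists_le_ker_of_lt_top _ hlt
      have hrep : ∀ x : κ → ℝ, φ x = ∑ k, φ (Pi.single k 1) * x k := by
        intro x
        have : x = ∑ k, x k • (Pi.single k 1 : κ → ℝ) := by
          ext j
          simp [Finset.sum_apply, Pi.single_apply]
        conv_lhs => rw [this]
        rw [map_sum]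
        refine Finset.sum_congr rfl fun k _ => ?_
        rw [map_smul, smul_eq_mul, mul_comm]
      have h0 := hsep (fun k => φ (Pi.single k 1)) (fun y => by
        rw [← hrep]
        exact hle (hcon y))
      apply hφ
      ext1 x
      ext1
      exact congrFun h0 x
    obtain ⟨y, hy⟩ := hex
    have hv' : LinearIndependent ℝ (fun o => Option.casesOn' o (f y) v : Option ι → κ → ℝ) :=
      linearIndependent_option'.mpr ⟨hv, hy⟩
    obtain ⟨z, hz⟩ := ih _ hv' (by simp; omega)
    refine ⟨Fin.cons y z, ?_⟩
    have := hz.comp (Sum.elim (fun i => Sum.inl (some i))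
      (Fin.cons (Sum.inl none) (fun j => Sum.inr j)) : ι ⊕ Fin (s + 1) → Option ι ⊕ Fin s) (by
        rintro (a | a) (b | b) h
        · simpa using h
        · revert h
          refine Fin.cases ?_ (fun b => ?_) b <;> simp
        · revert h
          refine Fin.cases ?_ (fun b => ?_) a <;> simp
        · revert h
          refine Fin.cases ?_ (fun a => ?_) a <;> refine Fin.cases ?_ (fun b => ?_) b <;> simp)
    convert this using 1
    ext (a | a) k
    · rfl
    · refine Fin.cases ?_ (fun a => ?_) a <;> simp

theorem loc_one {p κ C : Type} [Fintype p] [Fintype κ] [Fintype C] {f : (p → ℝ) → κ → ℝ}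
    {D : (p → ℝ) → (p → ℝ) →ₗ[ℝ] (κ → ℝ)} (h : GG f D C)
    (hsep : ∀ a : κ → ℝ, (∀ y, ∑ k, a k * f y k = 0) → a = 0) (s : ℕ)
    (hc : Fintype.card C * (1 + Fintype.card p) + s ≤ Fintype.card κ) :
    Loc f D (fun (_ : Unit) (_ : C) => (1 : ℝ)) (Fin s) := by
  classical
  obtain ⟨y, hy⟩ := h
  let v : C ⊕ (C × p) → κ → ℝ :=
    Sum.elim (fun c => f (y c)) (fun a => D (y a.1) (Pi.single a.2 1))
  have hsum : ∀ a : C ⊕ (C × p) → ℝ, ∀ k, (∑ i, a i • v i) k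
      = ∑ c, (a (Sum.inl c) * f (y c) k + D (y c) (fun j => a (Sum.inr (c, j))) k) := by
    intro a k
    rw [Fintype.sum_sum_type, Finset.sum_add_distrib, Pi.add_apply]
    congr 1
    · simp [v, Finset.sum_apply]
    · rw [Fintype.sum_prod_type, Finset.sum_apply]
      refine Finset.sum_congr rfl fun c _ => ?_
      have : (fun j => a (Sum.inr (c, j)))
          = ∑ j, a (Sum.inr (c, j)) • (Pi.single j 1 : p → ℝ) := by
        ext j
        simp [Finset.sum_apply, Pi.single_apply]
      rw [this, map_sum]
      simp [v]
  have hv : LinearIndependent ℝ v := by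
    rw [Fintype.linearIndependent_iff]
    intro a ha
    obtain ⟨h1, h2⟩ := hy (fun c => a (Sum.inl c)) (fun c j => a (Sum.inr (c, j))) (by
      intro k
      rw [← hsum, ha]; rfl)
    rintro (c | ⟨c, j⟩)
    · exact congrFun h1 c
    · exact congrFun (congrFun h2 c) j
  obtain ⟨z, hz⟩ := greedy f hsep s v hv (by
    simp only [Fintype.card_sum, Fintype.card_prod]
    linarith)
  refine ⟨y, z, fun A β B h => ?_⟩
  rw [Fintype.linearIndependent_iff] at hz
  have := hz (Sum.elim (Sum.elim (fun c => A () c) (fun a => β a.1 a.2)) (fun s => B () s)) (by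
    rw [Fintype.sum_sum_type]
    ext k
    rw [Pi.add_apply]
    simp only [Sum.elim_inl, Sum.elim_inr]
    rw [hsum, Finset.sum_apply]
    simpa using h () k)
  refine ⟨?_, ?_, ?_⟩
  · ext _ c; exact this (Sum.inl (Sum.inl c))
  · ext c j; exact this (Sum.inl (Sum.inr (c, j)))
  · ext _ c; exact this (Sum.inr c)

abbrev PI {k : ℕ} (d : Fin k → ℕ) : Type :=
  {q : Σ i : Fin k, Fin (d i) // (q.2 : ℕ) ≠ 0}

def emc {k : ℕ} {d : Fin k → ℕ} (y : PI d → ℝ) (i : Fin k) (j : Fin (d i)) : ℝ :=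
  if h : (j : ℕ) ≠ 0 then y ⟨⟨i, j⟩, h⟩ else 1

def demc {k : ℕ} {d : Fin k → ℕ} (y : PI d → ℝ) (i : Fin k) (j : Fin (d i)) : ℝ :=
  if h : (j : ℕ) ≠ 0 then y ⟨⟨i, j⟩, h⟩ else 0

def fk {k : ℕ} (d : Fin k → ℕ) (y : PI d → ℝ) (idx : (i : Fin k) → Fin (d i)) : ℝ :=
  ∏ i, emc y i (idx i)

noncomputable def Dk {k : ℕ} (d : Fin k → ℕ) (y : PI d → ℝ) :
    (PI d → ℝ) →ₗ[ℝ] (((i : Fin k) → Fin (d i)) → ℝ) where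
  toFun β idx := ∑ i, demc β i (idx i) * ∏ l ∈ Finset.univ.erase i, emc y l (idx l)
  map_add' β β' := by
    ext idx
    simp only [Pi.add_apply, ← Finset.sum_add_distrib, ← add_mul]
    refine Finset.sum_congr rfl fun i _ => ?_
    congr 1
    unfold demc
    split_ifs <;> simp
  map_smul' r β := by
    ext idx
    simp only [Pi.smul_apply, smul_eq_mul, Finset.mul_sum, ← mul_assoc, RingHom.id_apply]
    refine Finset.sum_congr rfl fun i _ => ?_
    congr 1
    unfold demc
    split_ifs <;> simp

theorem fk_poly {k : ℕ} (d : Fin k → ℕ) (idx) : PolyFun (fun y => fk d y idx) := by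
  unfold fk
  refine PolyFun.prod _ fun i => ?_
  unfold emc
  split_ifs
  · exact PolyFun.coord _
  · exact PolyFun.const _

theorem Dk_poly {k : ℕ} (d : Fin k → ℕ) (β) (idx) : PolyFun (fun y => Dk d y β idx) := by
  change PolyFun (fun y => ∑ i, demc β i (idx i) * ∏ l ∈ Finset.univ.erase i, emc y l (idx l))
  refine PolyFun.sum _ fun i => (PolyFun.const _).mul (PolyFun.prod _ fun i => ?_)
  unfold emc
  split_ifs
  · exact PolyFun.coord _
  · exact PolyFun.const _

theorem prod_erase_zero {k : ℕ} (g : Fin (k + 1) → ℝ) :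
    ∏ l ∈ Finset.univ.erase 0, g l = ∏ l : Fin k, g l.succ := by
  have : (Finset.univ.erase 0 : Finset (Fin (k + 1)))
      = Finset.univ.map ⟨Fin.succ, Fin.succ_injective k⟩ := by
    ext i
    refine Fin.cases ?_ (fun i => ?_) i <;> simp
  rw [this, Finset.prod_map]
  rfl

theorem prod_erase_succ {k : ℕ} (g : Fin (k + 1) → ℝ) (i : Fin k) :
    ∏ l ∈ Finset.univ.erase i.succ, g l
      = g 0 * ∏ l ∈ Finset.univ.erase i, g (Fin.succ l) := by
  have : (Finset.univ.erase i.succ : Finset (Fin (k + 1)))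
      = insert 0 ((Finset.univ.erase i).map ⟨Fin.succ, Fin.succ_injective k⟩) := by
    ext j
    refine Fin.cases ?_ (fun j => ?_) j
    · simp [Fin.succ_ne_zero, eq_comm]
    · simp
  rw [this, Finset.prod_insert (by simp), Finset.prod_map]
  rfl

/-- parameters of the tail -/
def tl {k : ℕ} {d : Fin (k + 1) → ℕ} (y : PI d → ℝ) : PI (fun i : Fin k => d i.succ) → ℝ :=
  fun q => y ⟨⟨q.1.1.succ, q.1.2⟩, q.2⟩

theorem fk_succ {k : ℕ} (d : Fin (k + 1) → ℕ) (y : PI d → ℝ) (idx) :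
    fk d y idx = emc y 0 (idx 0) * fk (fun i : Fin k => d i.succ) (tl y) (fun i => idx i.succ) := by
  unfold fk
  rw [Fin.prod_univ_succ]
  rfl

theorem Dk_succ {k : ℕ} (d : Fin (k + 1) → ℕ) (y β : PI d → ℝ) (idx) :
    Dk d y β idx = demc β 0 (idx 0) * fk (fun i : Fin k => d i.succ) (tl y) (fun i => idx i.succ)
      + emc y 0 (idx 0) *
        Dk (fun i : Fin k => d i.succ) (tl y) (tl β) (fun i => idx i.succ) := by
  simp only [Dk, LinearMap.coe_mk, AddHom.coe_mk]
  rw [Fin.sum_univ_succ, prod_erase_zero, Finset.mul_sum]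
  congr 1
  refine Finset.sum_congr rfl fun i _ => ?_
  rw [prod_erase_succ, mul_left_comm]
  rfl

def mkp {k : ℕ} {d : Fin (k + 1) → ℕ} (u : Fin (d 0) → ℝ)
    (y : PI (fun i : Fin k => d i.succ) → ℝ) : PI d → ℝ :=
  fun q => Fin.cases (motive := fun i => ∀ j : Fin (d i), (j : ℕ) ≠ 0 → ℝ)
    (fun j _ => u j) (fun i j h => y ⟨⟨i, j⟩, h⟩) q.1.1 q.1.2 q.2

theorem tl_mkp {k : ℕ} {d : Fin (k + 1) → ℕ} (u : Fin (d 0) → ℝ)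
    (y : PI (fun i : Fin k => d i.succ) → ℝ) : tl (mkp u y : PI d → ℝ) = y := rfl

theorem emc_mkp {k : ℕ} {d : Fin (k + 1) → ℕ} (u : Fin (d 0) → ℝ)
    (y : PI (fun i : Fin k => d i.succ) → ℝ) (hu : ∀ j : Fin (d 0), (j : ℕ) = 0 → u j = 1) (j) :
    emc (mkp u y : PI d → ℝ) 0 j = u j := by
  unfold emc
  split_ifs with h
  · rfl
  · rw [hu j (by simpa using h)]

theorem fk_sep {k : ℕ} (d : Fin k → ℕ) (a : ((i : Fin k) → Fin (d i)) → ℝ)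
    (h : ∀ y, ∑ idx, a idx * fk d y idx = 0) : a = 0 := by
  induction k with
  | zero =>
    ext idx
    have := h 0
    simp [fk] at this
    rw [Subsingleton.elim idx default]; exact this
  | succ k ih =>
    let b : Fin (d 0) → (PI (fun i : Fin k => d i.succ) → ℝ) → ℝ := fun j y =>
      ∑ idx, a (Fin.cons j idx) * fk (fun i : Fin k => d i.succ) y idx
    have hb : ∀ u : Fin (d 0) → ℝ, (∀ j : Fin (d 0), (j : ℕ) = 0 → u j = 1) → ∀ y,
        ∑ j, u j * b j y = 0 := by
      intro u hu y
      rw [← h (mkp u y), ← (Fin.consEquiv (fun i => Fin (d i))).sum_comp, Fintype.sum_prod_type]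
      refine Finset.sum_congr rfl fun j _ => ?_
      simp only [b, Finset.mul_sum]
      refine Finset.sum_congr rfl fun idx _ => ?_
      rw [fk_succ, tl_mkp, emc_mkp _ _ hu]
      simp only [Fin.consEquiv, Equiv.coe_fn_mk, Fin.cons_zero, Fin.cons_succ]
      ring
    have hb0 : ∀ j y, b j y = 0 := by
      intro j y
      have h0 := hb (fun j => if (j : ℕ) = 0 then 1 else 0) (fun j hj => by simp [hj]) y
      by_cases hj : (j : ℕ) = 0
      · have : ∀ i : Fin (d 0), ((i : ℕ) = 0) = (i = j) := fun i => by
          rw [Fin.ext_iff, hj]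
        simpa [this] using h0
      · have h1 := hb (fun i => (if (i : ℕ) = 0 then 1 else 0) + if i = j then 1 else 0)
          (fun i hi => by
            have : i ≠ j := fun h => hj (h ▸ hi)
            simp [hi, this]) y
        simp only [add_mul, Finset.sum_add_distrib, h0] at h1
        simpa using h1
    ext idx
    have := ih (fun i => d i.succ) (fun idx' => a (Fin.cons (idx 0) idx')) (fun y => hb0 (idx 0) y)
    have := congrFun this (fun i => idx i.succ)
    simp only [Pi.zero_apply] at this ⊢
    rw [← this]
    congr 1
    exact (Fin.cons_self_tail idx).symm

theorem GG_of_HH {k : ℕ} (d : Fin (k + 1) → ℕ) (h0 : 0 < d 0) {C : Type*} [Fintype C]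
    (h : HH (fk (fun i : Fin k => d i.succ)) (Dk (fun i : Fin k => d i.succ)) (Fin (d 0)) ⟨0, h0⟩ C) :
    GG (fk d) (Dk d) C := by
  obtain ⟨U, y, hU, h⟩ := h
  have hu : ∀ c, ∀ j : Fin (d 0), (j : ℕ) = 0 → U j c = 1 := fun c j hj => by
    rw [← hU c]; congr 1; exact Fin.ext hj
  refine ⟨fun c => mkp (fun j => U j c) (y c), fun α β hz => ?_⟩
  obtain ⟨h1, h2⟩ := h (fun j c => α c * U j c + demc (β c) 0 j) (fun c => tl (β c)) (by
    intro j idx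
    rw [← hz (Fin.cons j idx)]
    refine Finset.sum_congr rfl fun c _ => ?_
    rw [fk_succ, Dk_succ, tl_mkp, emc_mkp _ _ (hu c)]
    simp only [Fin.cons_zero, Fin.cons_succ]
    ring)
  have hα : ∀ c, α c = 0 := fun c => by
    have := congrFun (congrFun h1 ⟨0, h0⟩) c
    simpa [hU, demc] using this
  refine ⟨funext hα, ?_⟩
  ext c ⟨⟨i, j⟩, hj⟩
  revert j
  refine Fin.cases ?_ (fun i => ?_) i
  · intro j hj
    have := congrFun (congrFun h1 j) c
    have hj' : (j : ℕ) ≠ 0 := hj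
    simpa [hα, demc, hj'] using this
  · intro j hj
    exact congrFun (congrFun h2 c) ⟨⟨i, j⟩, hj⟩

theorem card_PI {k : ℕ} (d : Fin k → ℕ) : Fintype.card (PI d) = ∑ i, (d i - 1) := by
  let e : PI d ≃ Σ i : Fin k, {j : Fin (d i) // (j : ℕ) ≠ 0} :=
    { toFun := fun q => ⟨q.1.1, ⟨q.1.2, q.2⟩⟩
      invFun := fun q => ⟨⟨q.1, q.2.1⟩, q.2.2⟩
      left_inv := fun q => rfl
      right_inv := fun q => rfl }
  rw [Fintype.card_congr e, Fintype.card_sigma]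
  refine Finset.sum_congr rfl fun i _ => ?_
  rw [Fintype.card_subtype_compl]
  rcases Nat.eq_zero_or_pos (d i) with h | h
  · simp [h]
  · have : Fintype.card {j : Fin (d i) // (j : ℕ) = 0} = 1 := by
      rw [Fintype.card_eq_one_iff]
      exact ⟨⟨⟨0, h⟩, rfl⟩, fun x => Subtype.ext (Fin.ext x.2)⟩
    simp [this]


abbrev XT (q : ℕ) (R S : Type) : Type := (R × S) ⊕ ((Fin q × S) ⊕ (R × Fin q))

noncomputable def XU {q : ℕ} {R S V : Type} [AddCommGroup V] [Module ℝ V]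
    (F : (Fin q × Bool) ⊕ R → V) : XT q R S → V :=
  Sum.elim (fun x => F (Sum.inr x.1))
    (Sum.elim (fun x => (2⁻¹ : ℝ) • (F (Sum.inl (x.1, false)) + F (Sum.inl (x.1, true))))
      (fun x => F (Sum.inr x.1)))

noncomputable def XV {q : ℕ} {R S V : Type} [AddCommGroup V] [Module ℝ V]
    (F : (Fin q × Bool) ⊕ S → V) : XT q R S → V :=
  Sum.elim (fun x => F (Sum.inr x.2))
    (Sum.elim (fun x => F (Sum.inr x.2))
      (fun x => (2⁻¹ : ℝ) • (F (Sum.inl (x.2, false)) + F (Sum.inl (x.2, true)))))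

theorem base_core {q : ℕ} {R S : Type} [Fintype R] [Fintype S] [DecidableEq R] [DecidableEq S]
    (s : Fin q × Bool → ℝ) (hs : Function.Injective s)
    (A : Fin 2 → Fin q × Bool → ℝ) (al : Fin q × Bool → (Fin q × Bool) ⊕ R → ℝ)
    (be : Fin q × Bool → (Fin q × Bool) ⊕ S → ℝ) (B : Fin 2 → XT q R S → ℝ)
    (hal : ∀ c, ∑ r, al c r = 0) (hbe : ∀ c, ∑ r, be c r = 0)
    (hz : ∀ i ρ σ, ∑ c, (A i c * ((Pi.single (Sum.inl c) 1 : _ → ℝ) ρ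
          * (Pi.single (Sum.inl c) 1 : _ → ℝ) σ)
        + ![fun _ => 1, s] i c * (al c ρ * (Pi.single (Sum.inl c) 1 : _ → ℝ) σ
          + (Pi.single (Sum.inl c) 1 : _ → ℝ) ρ * be c σ))
      + ∑ x, B i x * (XU (fun r => (Pi.single r 1 : _ → ℝ)) x ρ
          * XV (fun r => (Pi.single r 1 : _ → ℝ)) x σ) = 0) :
    A = 0 ∧ al = 0 ∧ be = 0 ∧ B = 0 := by
  have h1 : ∀ i ρ σ, B i (Sum.inl (ρ, σ)) = 0 := by
    intro i ρ σ
    have := hz i (Sum.inr ρ) (Sum.inr σ)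
    simpa [XU, XV, Fintype.sum_sum_type, Fintype.sum_prod_type, Pi.single_apply] using this
  have h2 : ∀ i m ε σ, ![fun _ => 1, s] i (m, ε) * be (m, ε) (Sum.inr σ)
      + B i (Sum.inr (Sum.inl (m, σ))) * 2⁻¹ = 0 := by
    intro i m ε σ
    have := hz i (Sum.inl (m, ε)) (Sum.inr σ)
    cases ε <;> simpa [XU, XV, Fintype.sum_sum_type, Fintype.sum_prod_type, Pi.single_apply,
      Prod.mk.injEq, h1] using this
  have h3 : ∀ i m ε ρ, ![fun _ => 1, s] i (m, ε) * al (m, ε) (Sum.inr ρ)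
      + B i (Sum.inr (Sum.inr (ρ, m))) * 2⁻¹ = 0 := by
    intro i m ε σ
    have := hz i (Sum.inr σ) (Sum.inl (m, ε))
    cases ε <;> simpa [XU, XV, Fintype.sum_sum_type, Fintype.sum_prod_type, Pi.single_apply,
      Prod.mk.injEq, h1] using this
  have h4 : ∀ i c c', A i c * (if c' = c then 1 else 0) + (![fun _ => 1, s] i c' * al c' (Sum.inl c)
      + ![fun _ => 1, s] i c * be c (Sum.inl c')) = 0 := by
    intro i c c'
    have := hz i (Sum.inl c) (Sum.inl c')
    refine Eq.trans ?_ this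
    have hx : ∑ x, B i x * (XU (fun r => (Pi.single r 1 : _ → ℝ)) x (Sum.inl c)
          * XV (fun r => (Pi.single r 1 : _ → ℝ)) x (Sum.inl c')) = 0 := by
      simp [XU, XV, Fintype.sum_sum_type]
    rw [hx, add_zero, Finset.sum_add_distrib]
    congr 1
    · simp only [Pi.single_apply, Sum.inl.injEq]
      by_cases h : c' = c
      · subst h; simp
      · simp [h, Ne.symm h]
    · simp [Pi.single_apply, mul_add, Finset.sum_add_distrib]
  have hbe1 : ∀ m ε σ, be (m, ε) (Sum.inr σ) = 0 ∧ ∀ i, B i (Sum.inr (Sum.inl (m, σ))) = 0 := by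
    intro m ε σ
    have e1 := h2 0 m false σ
    have e2 := h2 0 m true σ
    have e3 := h2 1 m false σ
    have e4 := h2 1 m true σ
    simp only [Matrix.cons_val_zero, Matrix.cons_val_one, one_mul] at e1 e2 e3 e4
    have hne : s (m, false) - s (m, true) ≠ 0 := sub_ne_zero.mpr fun h => by
      simpa using hs h
    have hb : be (m, false) (Sum.inr σ) = 0 := by
      have h5 : be (m, true) (Sum.inr σ) = be (m, false) (Sum.inr σ) := by linarith
      rw [h5] at e4
      have : (s (m, false) - s (m, true)) * be (m, false) (Sum.inr σ) = 0 := by linarith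
      exact (mul_eq_zero.mp this).resolve_left hne
    rw [hb] at e1 e3
    have hB0 : B 0 (Sum.inr (Sum.inl (m, σ))) = 0 := by linarith
    have hB1 : B 1 (Sum.inr (Sum.inl (m, σ))) = 0 := by linarith
    refine ⟨?_, fun i => ?_⟩
    · cases ε
      · exact hb
      · linarith
    · fin_cases i
      · exact hB0
      · exact hB1
  have hal1 : ∀ m ε ρ, al (m, ε) (Sum.inr ρ) = 0 ∧ ∀ i, B i (Sum.inr (Sum.inr (ρ, m))) = 0 := by
    intro m ε σ
    have e1 := h3 0 m false σ
    have e2 := h3 0 m true σ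
    have e3 := h3 1 m false σ
    have e4 := h3 1 m true σ
    simp only [Matrix.cons_val_zero, Matrix.cons_val_one, one_mul] at e1 e2 e3 e4
    have hne : s (m, false) - s (m, true) ≠ 0 := sub_ne_zero.mpr fun h => by
      simpa using hs h
    have hb : al (m, false) (Sum.inr σ) = 0 := by
      have h5 : al (m, true) (Sum.inr σ) = al (m, false) (Sum.inr σ) := by linarith
      rw [h5] at e4
      have : (s (m, false) - s (m, true)) * al (m, false) (Sum.inr σ) = 0 := by linarith
      exact (mul_eq_zero.mp this).resolve_left hne
    rw [hb] at e1 e3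
    have hB0 : B 0 (Sum.inr (Sum.inr (σ, m))) = 0 := by linarith
    have hB1 : B 1 (Sum.inr (Sum.inr (σ, m))) = 0 := by linarith
    refine ⟨?_, fun i => ?_⟩
    · cases ε
      · exact hb
      · linarith
    · fin_cases i
      · exact hB0
      · exact hB1
  have hoff : ∀ c c', c' ≠ c → al c' (Sum.inl c) = 0 ∧ be c (Sum.inl c') = 0 := by
    intro c c' hc
    have e1 := h4 0 c c'
    have e2 := h4 1 c c'
    simp only [Matrix.cons_val_zero, Matrix.cons_val_one, one_mul, if_neg hc, mul_zero,
      zero_add] at e1 e2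
    have hne : s c' - s c ≠ 0 := sub_ne_zero.mpr fun h => hc (hs h)
    have h5 : be c (Sum.inl c') = - al c' (Sum.inl c) := by linarith
    rw [h5] at e2
    have : (s c' - s c) * al c' (Sum.inl c) = 0 := by linarith
    have h6 := (mul_eq_zero.mp this).resolve_left hne
    exact ⟨h6, by rw [h5, h6, neg_zero]⟩
  have hal0 : ∀ c ρ, al c ρ = 0 := by
    intro c ρ
    have hne : ∀ ρ, ρ ≠ Sum.inl c → al c ρ = 0 := by
      rintro (c' | ρ) h
      · exact (hoff c' c (fun h' => h (by rw [h']))).1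
      · exact (hal1 c.1 c.2 ρ).1
    by_cases h : ρ = Sum.inl c
    · subst h
      rw [← hal c]
      exact (Finset.sum_eq_single _ (fun b _ hb => hne b hb) (by simp)).symm
    · exact hne ρ h
  have hbe0 : ∀ c ρ, be c ρ = 0 := by
    intro c ρ
    have hne : ∀ ρ, ρ ≠ Sum.inl c → be c ρ = 0 := by
      rintro (c' | ρ) h
      · exact (hoff c c' (fun h' => h (by rw [h']))).2
      · exact (hbe1 c.1 c.2 ρ).1
    by_cases h : ρ = Sum.inl c
    · subst h
      rw [← hbe c]
      exact (Finset.sum_eq_single _ (fun b _ hb => hne b hb) (by simp)).symm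
    · exact hne ρ h
  refine ⟨?_, funext fun c => funext fun ρ => hal0 c ρ, funext fun c => funext fun ρ => hbe0 c ρ, ?_⟩
  · ext i c
    have := h4 i c c
    simpa [hal0, hbe0] using this
  · ext i (⟨ρ, σ⟩ | ⟨m, σ⟩ | ⟨ρ, m⟩)
    · exact h1 i ρ σ
    · exact (hbe1 m false σ).2 i
    · exact (hal1 m false ρ).2 i

theorem exists_basis {n : ℕ} (hn : 0 < n) {R : Type} [Fintype R] [DecidableEq R]
    (e : R ≃ Fin n) :
    ∃ (F : R → Fin n → ℝ) (T : (Fin n → ℝ) ≃ₗ[ℝ] (R → ℝ)), (∀ r, F r ⟨0, hn⟩ = 1) ∧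
      (∀ r, T (F r) = Pi.single r 1) ∧ ∀ w, ∑ r, T w r = w ⟨0, hn⟩ := by
  let F : R → Fin n → ℝ := fun r j => if j = ⟨0, hn⟩ then 1 else if j = e r then 1 else 0
  have hli : LinearIndependent ℝ F := by
    rw [Fintype.linearIndependent_iff]
    intro a ha
    have h1 : ∀ r, e r ≠ ⟨0, hn⟩ → a r = 0 := by
      intro r hr
      have := congrFun ha (e r)
      simpa [Finset.sum_apply, F, hr, e.injective.eq_iff] using this
    intro r
    by_cases hr : e r = ⟨0, hn⟩
    · have h2 := congrFun ha ⟨0, hn⟩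
      simp only [Finset.sum_apply, Pi.smul_apply, F, if_true, smul_eq_mul, mul_one,
        Pi.zero_apply] at h2
      rw [← h2]
      refine (Finset.sum_eq_single r (fun b _ hb => h1 b fun h => hb ?_) (by simp)).symm
      exact e.injective (h.trans hr.symm)
    · exact h1 r hr
  have : Nonempty R := ⟨e.symm ⟨0, hn⟩⟩
  let b := basisOfLinearIndependentOfCardEqFinrank hli (by
    rw [Module.finrank_fintype_fun_eq_card]; exact Fintype.card_congr e)
  have hb : ∀ r, b r = F r := fun r => by simp [b]
  refine ⟨F, b.equivFun, fun r => by simp [F], fun r => ?_, fun w => ?_⟩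
  · ext j
    rw [← hb, Module.Basis.equivFun_self]
    simp [Pi.single_apply, eq_comm]
  · have := congrFun (b.sum_equivFun w) ⟨0, hn⟩
    rw [← this]
    simp [Finset.sum_apply, hb, F]

noncomputable def pr {d : Fin 2 → ℕ} (u : Fin (d 0) → ℝ) (v : Fin (d 1) → ℝ) : PI d → ℝ :=
  mkp u (mkp (d := fun i : Fin 1 => d i.succ) v (fun q => q.1.1.elim0))

theorem fk_pr {d : Fin 2 → ℕ} (u : Fin (d 0) → ℝ) (v : Fin (d 1) → ℝ)
    (hu : ∀ j : Fin (d 0), (j : ℕ) = 0 → u j = 1) (hv : ∀ j : Fin (d 1), (j : ℕ) = 0 → v j = 1)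
    (idx) : fk d (pr u v) idx = u (idx 0) * v (idx 1) := by
  unfold pr
  rw [fk_succ, tl_mkp, emc_mkp _ _ hu, fk_succ, emc_mkp _ _ hv]
  simp [fk]

theorem Dk_pr {d : Fin 2 → ℕ} (u : Fin (d 0) → ℝ) (v : Fin (d 1) → ℝ)
    (hu : ∀ j : Fin (d 0), (j : ℕ) = 0 → u j = 1) (hv : ∀ j : Fin (d 1), (j : ℕ) = 0 → v j = 1)
    (β) (idx) : Dk d (pr u v) β idx
      = demc β 0 (idx 0) * v (idx 1) + u (idx 0) * demc β 1 (idx 1) := by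
  unfold pr
  rw [Dk_succ, tl_mkp, emc_mkp _ _ hu, fk_succ, Dk_succ, emc_mkp _ _ hv, tl_mkp]
  simp [fk, Dk]
  left; rfl

theorem loc_two (d : Fin 2 → ℕ) (q : ℕ) (hb : 0 < d 0) (hc : 0 < d 1)
    (h0 : 2 * q ≤ d 0) (h1 : 2 * q ≤ d 1) (s : Fin q × Bool → ℝ) (hs : Function.Injective s) :
    Loc (fk d) (Dk d) (![fun _ => 1, s] : Fin 2 → Fin q × Bool → ℝ)
      (XT q (Fin (d 0 - 2 * q)) (Fin (d 1 - 2 * q))) := by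
  have e0 : (Fin q × Bool) ⊕ Fin (d 0 - 2 * q) ≃ Fin (d 0) :=
    Fintype.equivFinOfCardEq (by simp; omega)
  have e1 : (Fin q × Bool) ⊕ Fin (d 1 - 2 * q) ≃ Fin (d 1) :=
    Fintype.equivFinOfCardEq (by simp; omega)
  obtain ⟨F, T, hF, hT, hTs⟩ := exists_basis hb e0
  obtain ⟨F', T', hF', hT', hTs'⟩ := exists_basis hc e1
  have hF1 : ∀ r, ∀ j : Fin (d 0), (j : ℕ) = 0 → F r j = 1 := fun r j hj => by
    rw [← hF r]; congr 1; exact Fin.ext hj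
  have hF1' : ∀ r, ∀ j : Fin (d 1), (j : ℕ) = 0 → F' r j = 1 := fun r j hj => by
    rw [← hF' r]; congr 1; exact Fin.ext hj
  have hXU : ∀ x : XT q (Fin (d 0 - 2 * q)) (Fin (d 1 - 2 * q)),
      ∀ j : Fin (d 0), (j : ℕ) = 0 → XU F x j = 1 := by
    rintro (x | x | x) j hj <;> simp [XU, hF1 _ j hj]
    norm_num
  have hXV : ∀ x : XT q (Fin (d 0 - 2 * q)) (Fin (d 1 - 2 * q)),
      ∀ j : Fin (d 1), (j : ℕ) = 0 → XV F' x j = 1 := by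
    rintro (x | x | x) j hj <;> simp [XV, hF1' _ j hj]
    norm_num
  have hTU : ∀ x : XT q (Fin (d 0 - 2 * q)) (Fin (d 1 - 2 * q)),
      T (XU F x) = XU (fun r => Pi.single r 1) x := by
    rintro (x | x | x) <;> simp [XU, hT]
  have hTV : ∀ x : XT q (Fin (d 0 - 2 * q)) (Fin (d 1 - 2 * q)),
      T' (XV F' x) = XV (fun r => Pi.single r 1) x := by
    rintro (x | x | x) <;> simp [XV, hT']
  refine ⟨fun c => pr (F (Sum.inl c)) (F' (Sum.inl c)), fun x => pr (XU F x) (XV F' x),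
    fun A β B hz => ?_⟩
  have key : ∀ ρ σ, ∃ Ψ : (Fin (d 0) → Fin (d 1) → ℝ) →ₗ[ℝ] ℝ,
      (∀ u v, Ψ (fun j k => u j * v k) = T u ρ * T' v σ) := by
    intro ρ σ
    let Ψ : (Fin (d 0) → Fin (d 1) → ℝ) →ₗ[ℝ] ℝ :=
      { toFun := fun M => T (fun j => T' (M j) σ) ρ
        map_add' := fun M M' => by
          have : (fun j => T' ((M + M') j) σ) = (fun j => T' (M j) σ) + (fun j => T' (M' j) σ) := by
            ext j
            simp
          rw [this, map_add, Pi.add_apply]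
        map_smul' := fun r M => by
          have : (fun j => T' ((r • M) j) σ) = r • (fun j => T' (M j) σ) := by
            ext j
            simp
          rw [this, map_smul, Pi.smul_apply, RingHom.id_apply] }
    refine ⟨Ψ, fun u v => ?_⟩
    change T (fun j => T' (fun k => u j * v k) σ) ρ = _
    have h1 : (fun j => T' (fun k => u j * v k) σ) = T' v σ • u := by
      ext j
      have : (fun k => u j * v k) = u j • v := rfl
      rw [this, map_smul, Pi.smul_apply, Pi.smul_apply, smul_eq_mul, smul_eq_mul, mul_comm]
    rw [h1, map_smul, Pi.smul_apply, smul_eq_mul, mul_comm]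
  obtain ⟨hA, hal, hbe, hB⟩ := base_core s hs A (fun c => T (demc (β c) 0))
    (fun c => T' (demc (β c) 1)) B
    (fun c => by rw [hTs]; simp [demc]) (fun c => by rw [hTs']; simp [demc]) (by
      intro i ρ σ
      obtain ⟨Ψ, hΨ⟩ := key ρ σ
      have hmat : (∑ c, (A i c • (fun j k => F (Sum.inl c) j * F' (Sum.inl c) k)
            + (![fun _ => 1, s] : Fin 2 → Fin q × Bool → ℝ) i c •
              ((fun j k => demc (β c) 0 j * F' (Sum.inl c) k)
              + (fun j k => F (Sum.inl c) j * demc (β c) 1 k)))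
          + ∑ x, B i x • (fun j k => XU F x j * XV F' x k)
          : Fin (d 0) → Fin (d 1) → ℝ) = 0 := by
        ext j k
        let idx : (i : Fin 2) → Fin (d i) := Fin.cons j (Fin.cons k (fun i => i.elim0))
        have := hz i idx
        simp only [fk_pr _ _ (hF1 _) (hF1' _), Dk_pr _ _ (hF1 _) (hF1' _),
          fk_pr _ _ (hXU _) (hXV _)] at this
        have i0 : idx 0 = j := rfl
        have i1 : idx 1 = k := rfl
        rw [i0, i1] at this
        simp only [Finset.sum_apply, Pi.add_apply, Pi.smul_apply, smul_eq_mul, Pi.zero_apply]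
        exact this
      have := congrArg Ψ hmat
      simpa only [map_add, map_sum, map_smul, hΨ, hT, hT', hTU, hTV, smul_eq_mul, map_zero]
        using this)
  refine ⟨hA, ?_, hB⟩
  ext c ⟨⟨i, j⟩, hj⟩
  have ha : demc (β c) 0 = 0 := by
    have := congrFun hal c
    simpa using this
  have hb : demc (β c) 1 = 0 := by
    have := congrFun hbe c
    simpa using this
  have hj' : (j : ℕ) ≠ 0 := hj
  have hi : i = 0 ∨ i = 1 := by omega
  rcases hi with rfl | rfl
  · have := congrFun ha j
    simpa [demc, hj'] using this
  · have := congrFun hb j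
    simpa [demc, hj'] using this


theorem step {k : ℕ} (d : Fin (k + 1) → ℕ) (h0 : 0 < d 0) (q : ℕ)
    (hG : GG (fk (fun i : Fin k => d i.succ)) (Dk (fun i : Fin k => d i.succ)) (Fin q))
    (hq : q * (d 0 + ∑ i : Fin k, (d i.succ - 1)) ≤ ∏ i : Fin k, d i.succ)
    (r : ℕ) (hr : r ≤ d 0 * q) :
    HH (fk (fun i : Fin k => d i.succ)) (Dk (fun i : Fin k => d i.succ)) (Fin (d 0)) ⟨0, h0⟩
      (Fin r) := by
  have hloc := loc_one hG (fk_sep _) ((d 0 - 1) * q) (by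
    rw [card_PI, Fintype.card_pi]
    simp only [Fintype.card_fin]
    refine le_trans (le_of_eq ?_) hq
    obtain ⟨n, hn⟩ : ∃ n, d 0 = n + 1 := ⟨d 0 - 1, by omega⟩
    rw [hn, Nat.add_sub_cancel]
    ring)
  have hc : ∀ g : Fin (d 0), ∃ y : Fin (d 0) × Fin q → _ → ℝ, Cond _ _ _ g y := fun g =>
    loc_cond hloc g (Function.Embedding.nonempty_of_card_le (by simp)).some
  have hb := block () (fun _ => rfl) (cond_generic (fk_poly _) (Dk_poly _) hc) (⟨0, h0⟩ : Fin (d 0))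
    (Equiv.prodPUnit (Fin (d 0))).toEmbedding
  exact HH_mono (Function.Embedding.nonempty_of_card_le (by simpa using hr)).some hb

theorem base_arith (t b' c' b c q : ℕ) (hbc : c' ≤ b') (htb : b' ≤ t) (hb : b' ≤ b) (hc : c' ≤ c)
    (hc' : 2 ≤ c') (hq : q * (t + b' + c' - 2) ≤ b' * c') :
    2 * q ≤ c' ∧ q * (t - 2) ≤
      (b - 2 * q) * (c - 2 * q) + (q * (c - 2 * q) + (b - 2 * q) * q) := by
  obtain ⟨γ, rfl⟩ : ∃ γ, c' = γ + 2 := ⟨c' - 2, by omega⟩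
  have e1 : t + b' + (γ + 2) - 2 = t + b' + γ := by omega
  rw [e1] at hq
  have h2 : 2 * q ≤ γ + 2 := by
    by_contra hcon
    push Not at hcon
    nlinarith
  refine ⟨h2, ?_⟩
  obtain ⟨t, rfl⟩ : ∃ s, t = s + 2 := ⟨t - 2, by omega⟩
  obtain ⟨β, rfl⟩ : ∃ s, b = s + 2 * q := ⟨b - 2 * q, by omega⟩
  obtain ⟨δ, rfl⟩ : ∃ s, c = s + 2 * q := ⟨c - 2 * q, by omega⟩
  simp only [Nat.add_sub_cancel]
  obtain ⟨u, hu⟩ : ∃ u, β + 2 * q = b' + u := ⟨β + 2 * q - b', by omega⟩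
  obtain ⟨v, hv⟩ : ∃ v, δ + 2 * q = γ + 2 + v := ⟨δ + 2 * q - (γ + 2), by omega⟩
  have h3 : q * u ≤ (γ + 2) * u := Nat.mul_le_mul_right _ (by omega)
  have h4 : q * v ≤ (β + 2 * q) * v := Nat.mul_le_mul_right _ (by omega)
  zify at *
  have hβ : (β : ℤ) = b' + u - 2 * q := by linarith
  have hδ : (δ : ℤ) = γ + 2 + v - 2 * q := by linarith
  rw [hβ] at h4
  rw [hβ, hδ]
  nlinarith

theorem base3 (d : Fin 3 → ℕ) (h0 : 0 < d 0) (h01 : d 1 ≤ d 0) (h12 : d 2 ≤ d 1) (h3 : 3 ≤ d 2)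
    (r : ℕ) (hr : r ≤ rankBound3 (d 0) (d 1) (d 2)) :
    HH (fk (fun i : Fin 2 => d i.succ)) (Dk (fun i : Fin 2 => d i.succ)) (Fin (d 0)) ⟨0, h0⟩
      (Fin r) := by
  obtain ⟨n, hn, hn1, hn2⟩ : ∃ n, evenTrunc (d 0) = n * 2 ∧ 1 ≤ n ∧ n * 2 ≤ d 0 := by
    refine ⟨d 0 / 2, ?_, by omega, by omega⟩
    unfold evenTrunc
    split_ifs <;> omega
  unfold rankBound3 at hr
  simp only [hn] at hr
  set b' := min (d 1) (n * 2) with hb'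
  set c' := min (d 2) b' with hc'
  set q := b' * c' / (n * 2 + b' + c' - 2) with hq
  obtain ⟨hA, hB⟩ := base_arith (n * 2) b' c' (d 1) (d 2) q (by omega) (by omega) (by omega)
    (by omega) (by omega) (Nat.div_mul_le_self _ _)
  let s : Fin q × Bool → ℝ := fun x => ((Fintype.equivFin (Fin q × Bool) x : ℕ) : ℝ)
  have hs : Function.Injective s := by
    intro x y hxy
    simp only [s, Nat.cast_inj] at hxy
    exact (Fintype.equivFin _).injective (Fin.ext hxy)
  have hloc := loc_two (fun i : Fin 2 => d i.succ) q (by change 0 < d 1; omega)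
    (by change 0 < d 2; omega) (by change _ ≤ d 1; omega) (by change _ ≤ d 2; omega) s hs
  have hc : ∀ g : Fin n, ∃ y : Fin n × (Fin q × Bool) → _ → ℝ, Cond _ _ _ g y := fun g =>
    loc_cond hloc g (Function.Embedding.nonempty_of_card_le (by
      simp only [Fintype.card_prod, Fintype.card_sum, Fintype.card_fin, Fintype.card_bool,
        ne_eq, Fintype.card_subtype_compl, Fintype.card_unique]
      change (n - 1) * (q * 2) ≤ (d 1 - 2 * q) * (d 2 - 2 * q) + (q * (d 2 - 2 * q) +
        (d 1 - 2 * q) * q)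
      refine le_trans (le_of_eq ?_) hB
      obtain ⟨n, rfl⟩ : ∃ s, n = s + 1 := ⟨n - 1, by omega⟩
      have : (n + 1) * 2 - 2 = n * 2 := by omega
      rw [this, Nat.add_sub_cancel]
      ring)).some
  have hb := block (0 : Fin 2) (fun _ => by simp) (cond_generic (fk_poly _) (Dk_poly _) hc)
    (⟨0, hn1⟩ : Fin n)
    (finProdFinEquiv.toEmbedding.trans (Fin.castLEEmb hn2))
  have hz : (finProdFinEquiv.toEmbedding.trans (Fin.castLEEmb hn2)) ((⟨0, hn1⟩ : Fin n), (0 : Fin 2))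
      = ⟨0, h0⟩ := by
    ext
    simp
  rw [hz] at hb
  refine HH_mono (Function.Embedding.nonempty_of_card_le ?_).some hb
  simp only [Fintype.card_prod, Fintype.card_fin, Fintype.card_bool]
  rw [mul_comm q 2, ← mul_assoc]
  exact hr

theorem main_ind (m : ℕ) (N : ℕ → ℕ)
    (hmono : ∀ i j : ℕ, 1 ≤ i → i ≤ j → j ≤ m → N j ≤ N i) (hlast : 3 ≤ N m) (k : ℕ)
    (hk : 2 ≤ k) : k + 1 ≤ m → ∀ d : Fin (k + 1) → ℕ,
      (∀ i, d i = N (m - (k + 1) + 1 + i)) → ∀ (h0 : 0 < d 0) (r : ℕ), r ≤ rankBound N m (k + 1) →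
      HH (fk (fun i : Fin k => d i.succ)) (Dk (fun i : Fin k => d i.succ)) (Fin (d 0)) ⟨0, h0⟩
        (Fin r) := by
  induction k, hk using Nat.le_induction with
  | base =>
    intro hm d hd h0 r hr
    obtain ⟨M, rfl⟩ : ∃ M, m = M + 3 := ⟨m - 3, by omega⟩
    have e0 : d 0 = N (M + 1) := by rw [hd]; congr 1
    have e1 : d 1 = N (M + 2) := by rw [hd]; congr 1
    have e2 : d 2 = N (M + 3) := by rw [hd]; congr 1
    apply base3 d h0
    · rw [e0, e1]; exact hmono _ _ (by omega) (by omega) (by omega)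
    · rw [e1, e2]; exact hmono _ _ (by omega) (by omega) (by omega)
    · rw [e2]; exact hlast
    · rw [e0, e1, e2]
      exact hr
  | succ k hk ih =>
    intro hm d hd h0 r hr
    obtain ⟨l, rfl⟩ : ∃ l, k = l + 2 := ⟨k - 2, by omega⟩
    obtain ⟨M, rfl⟩ : ∃ M, m = M + (l + 4) := ⟨m - (l + 4), by omega⟩
    have hd' : ∀ i, d i = N (M + 1 + i) := by
      intro i; rw [hd]; congr 1; omega
    have hpos : ∀ i, 1 ≤ d i := by
      intro i
      rw [hd']
      have := hmono (M + 1 + i) (M + (l + 4)) (by omega) (by omega) le_rfl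
      omega
    change r ≤ rankBound N (M + (l + 4)) (l + 4) at hr
    rw [rankBound] at hr
    have hM : M + (l + 4) - (l + 4) = M := by omega
    rw [hM] at hr
    have hS : ∑ i ∈ Finset.Icc (M + 1) (M + (l + 4)), N i = ∑ i : Fin (l + 4), d i := by
      have : Finset.Icc (M + 1) (M + (l + 4)) = Finset.Ico (M + 1) (M + 1 + (l + 4)) := by
        ext; simp; omega
      rw [this, Finset.sum_Ico_eq_sum_range, Nat.add_sub_cancel_left, Finset.sum_range]
      exact Finset.sum_congr rfl fun i _ => (hd' i).symm
    have hP : ∏ i ∈ Finset.Icc (M + 2) (M + (l + 4)), N i = ∏ i : Fin (l + 3), d i.succ := by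
      have : Finset.Icc (M + 2) (M + (l + 4)) = Finset.Ico (M + 2) (M + 2 + (l + 3)) := by
        ext; simp; omega
      rw [this, Finset.prod_Ico_eq_prod_range, Nat.add_sub_cancel_left, Finset.prod_range]
      refine Finset.prod_congr rfl fun i _ => ?_
      rw [hd']; congr 1; simp; omega
    rw [hS, hP, Fin.sum_univ_succ] at hr
    have hden : d 0 + ∑ i : Fin (l + 3), d i.succ - (l + 4) + 1
        = d 0 + ∑ i : Fin (l + 3), (d i.succ - 1) := by
      have h1 : ∑ i : Fin (l + 3), d i.succ = ∑ i : Fin (l + 3), (d i.succ - 1) + (l + 3) := by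
        have : ∑ i : Fin (l + 3), d i.succ = ∑ i : Fin (l + 3), ((d i.succ - 1) + 1) :=
          Finset.sum_congr rfl fun i _ => by have := hpos i.succ; omega
        rw [this, Finset.sum_add_distrib]
        simp
      omega
    rw [hden] at hr
    have e0 : d 0 = N (M + 1) := by rw [hd']; congr 1
    rw [← e0] at hr
    refine step d h0 _ ?_ ?_ r hr
    · have h0' : 0 < d (Fin.succ 0) := hpos _
      exact GG_of_HH (fun i : Fin (l + 3) => d i.succ) h0'
        (ih (by omega) (fun i : Fin (l + 3) => d i.succ)
          (fun i => by rw [hd']; congr 1; simp; omega) h0' _ (min_le_left _ _))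
    · exact le_trans (Nat.mul_le_mul_right _ (min_le_right _ _)) (Nat.div_mul_le_self _ _)


def dEmb {m r : ℕ} {N : Fin m → ℕ}
    (x : FreeIdx m r N → ℝ) (i : Fin m) (j : Fin (N i)) (c : Fin r) : ℝ :=
  if h : (i : ℕ) = 0 ∨ ((j : ℕ) ≠ 0) then x ⟨⟨i, (j, c)⟩, h⟩ else 0

noncomputable def dEmbL {m r : ℕ} {N : Fin m → ℕ} (i : Fin m) (j : Fin (N i)) (c : Fin r) :
    (FreeIdx m r N → ℝ) →L[ℝ] ℝ :=
  if h : (i : ℕ) = 0 ∨ ((j : ℕ) ≠ 0) then ContinuousLinearMap.proj ⟨⟨i, (j, c)⟩, h⟩ else 0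

theorem dEmbL_apply {m r : ℕ} {N : Fin m → ℕ} (i : Fin m) (j : Fin (N i)) (c : Fin r)
    (v : FreeIdx m r N → ℝ) : dEmbL i j c v = dEmb v i j c := by
  unfold dEmbL dEmb
  split_ifs <;> simp

theorem hasFDerivAt_emb {m r : ℕ} {N : Fin m → ℕ} (i : Fin m) (j : Fin (N i)) (c : Fin r)
    (x : FreeIdx m r N → ℝ) :
    HasFDerivAt (fun x : FreeIdx m r N → ℝ => embOnes x i j c) (dEmbL i j c) x := by
  unfold dEmbL embOnes
  split_ifs
  · exact (ContinuousLinearMap.proj (R := ℝ) (φ := fun _ : FreeIdx m r N => ℝ) _).hasFDerivAt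
  · exact hasFDerivAt_const _ _

theorem fderiv_cpVec {m r : ℕ} {N : Fin m → ℕ} (x v : FreeIdx m r N → ℝ)
    (idx : (i : Fin m) → Fin (N i)) :
    fderiv ℝ (cpVec (m := m) (r := r) (N := N)) x v idx
      = ∑ c, ∑ i, dEmb v i (idx i) c * ∏ l ∈ Finset.univ.erase i, embOnes x l (idx l) c := by
  have h : ∀ idx : (i : Fin m) → Fin (N i),
      HasFDerivAt (fun x : FreeIdx m r N → ℝ => cpVec x idx)
        (∑ c, ∑ i, (∏ l ∈ Finset.univ.erase i, embOnes x l (idx l) c) • dEmbL i (idx i) c) x := by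
    intro idx
    unfold cpVec cpEntry
    refine HasFDerivAt.fun_sum fun c _ => ?_
    exact HasFDerivAt.finsetProd fun i _ => hasFDerivAt_emb i (idx i) c x
  have h2 := (hasFDerivAt_pi (φ := fun idx (x : FreeIdx m r N → ℝ) => cpVec x idx)).2 h
  have h3 : fderiv ℝ (cpVec (m := m) (r := r) (N := N)) x = _ := h2.fderiv
  rw [h3]
  simp only [ContinuousLinearMap.coe_pi', sum_apply,
    smul_apply, dEmbL_apply, smul_eq_mul]
  refine Finset.sum_congr rfl fun c _ => Finset.sum_congr rfl fun i _ => mul_comm _ _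

theorem final_aux {k r : ℕ} (d : Fin (k + 1) → ℕ) (h0 : 0 < d 0)
    (hH : HH (fk (fun i : Fin k => d i.succ)) (Dk (fun i : Fin k => d i.succ)) (Fin (d 0))
      ⟨0, h0⟩ (Fin r)) :
    ∃ x0 : FreeIdx (k + 1) r d → ℝ, ∀ v : FreeIdx (k + 1) r d → ℝ,
      (∀ idx, fderiv ℝ (cpVec (m := k + 1) (r := r) (N := d)) x0 v idx = 0) → v = 0 := by
  obtain ⟨U, y, -, h⟩ := hH
  let w : (i : Fin (k + 1)) → Fin (d i) → Fin r → ℝ :=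
    Fin.cases (fun j c => U j c) (fun i j c => emc (y c) i j)
  refine ⟨fun q => w q.1.1 q.1.2.1 q.1.2.2, fun v hv => ?_⟩
  have e0 : ∀ (i : Fin (k + 1)) (j : Fin (d i)) (c : Fin r), embOnes (N := d)
      (fun q : FreeIdx (k + 1) r d => w q.1.1 q.1.2.1 q.1.2.2) i j c = w i j c := by
    intro i j c
    unfold embOnes
    split_ifs with hh
    · rfl
    · push Not at hh
      obtain ⟨i, rfl⟩ := Fin.exists_succ_eq.2 (show i ≠ 0 from fun e => hh.1 (by simp [e]))
      simp [w, emc, hh.2]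
  simp only [fderiv_cpVec, e0] at hv
  obtain ⟨h1, h2⟩ := h (fun j c => dEmb v 0 j c)
    (fun c q => v ⟨⟨q.1.1.succ, (q.1.2, c)⟩, Or.inr q.2⟩) (by
      intro j idx
      rw [← hv (Fin.cons j idx)]
      refine Finset.sum_congr rfl fun c _ => ?_
      rw [Fin.sum_univ_succ, prod_erase_zero (fun l => w l ((Fin.cons j idx : (i : Fin (k + 1)) → Fin (d i)) l) c)]
      congr 1
      change U j c * ∑ i : Fin k, _ = _
      rw [Finset.mul_sum]
      refine Finset.sum_congr rfl fun i _ => ?_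
      rw [prod_erase_succ (fun l => w l ((Fin.cons j idx : (i : Fin (k + 1)) → Fin (d i)) l) c)]
      rw [mul_left_comm]
      congr 1
      simp [dEmb, demc])
  ext ⟨⟨i, j, c⟩, hq⟩
  refine Fin.cases (motive := fun i => ∀ (j : Fin (d i)) (hq : _), v ⟨⟨i, (j, c)⟩, hq⟩ = 0) ?_ ?_ i j hq
  · intro j hq
    have := congrFun (congrFun h1 j) c
    simpa [dEmb] using this
  · intro i j hq
    exact congrFun (congrFun h2 c) ⟨⟨i, j⟩, by simpa using hq⟩

theorem final_gen {k r : ℕ} (d : Fin (k + 1) → ℕ) (h0 : 0 < d 0)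
    (hH : HH (fk (fun i : Fin k => d i.succ)) (Dk (fun i : Fin k => d i.succ)) (Fin (d 0))
      ⟨0, h0⟩ (Fin r)) :
    ∃ P : MvPolynomial (FreeIdx (k + 1) r d) ℝ, P ≠ 0 ∧
      ∀ x : FreeIdx (k + 1) r d → ℝ, MvPolynomial.eval x P ≠ 0 →
        Function.Injective (fderiv ℝ (cpVec (m := k + 1) (r := r) (N := d)) x) := by
  classical
  obtain ⟨x0, hx0⟩ := final_aux d h0 hH
  have hlin : ∀ (x a : FreeIdx (k + 1) r d → ℝ) idx,
      ∑ i, a i * fderiv ℝ (cpVec (m := k + 1) (r := r) (N := d)) x (Pi.single i 1) idx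
        = fderiv ℝ (cpVec (m := k + 1) (r := r) (N := d)) x a idx := by
    intro x a idx
    have : a = ∑ i, a i • (Pi.single i 1 : FreeIdx (k + 1) r d → ℝ) := by
      ext j
      simp [Finset.sum_apply, Pi.single_apply]
    conv_rhs => rw [this]
    rw [map_sum, Finset.sum_apply]
    refine Finset.sum_congr rfl fun i _ => ?_
    rw [map_smul]
    rfl
  obtain ⟨P, hP, hall⟩ := inj_open (fun (i : FreeIdx (k + 1) r d) idx x =>
    fderiv ℝ (cpVec (m := k + 1) (r := r) (N := d)) x (Pi.single i 1) idx) (by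
      intro i idx
      simp only [fderiv_cpVec]
      refine PolyFun.sum _ fun c => PolyFun.sum _ fun i => (PolyFun.const _).mul
        (PolyFun.prod _ fun l => ?_)
      unfold embOnes
      split_ifs
      · exact PolyFun.coord _
      · exact PolyFun.const _) x0 (by
      intro a ha
      simp only [hlin] at ha
      exact hx0 a ha)
  refine ⟨P, fun e => hP (by simp [e]), fun x hx => ?_⟩
  rw [injective_iff_map_eq_zero]
  intro a ha
  refine hall x hx a fun idx => ?_
  rw [hlin, ha]
  rfl

theorem cp_jacobian_full_rank_general
    (m r : ℕ) (hm : 3 ≤ m) (N : ℕ → ℕ)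
    (hmono : ∀ i j : ℕ, 1 ≤ i → i ≤ j → j ≤ m → N j ≤ N i)
    (hlast : 3 ≤ N m)
    (hr : r ≤ rankBound N m m) :
    ∃ P : MvPolynomial (FreeIdx m r fun i => N ((i : ℕ) + 1)) ℝ, P ≠ 0 ∧
      ∀ x : FreeIdx m r (fun i => N ((i : ℕ) + 1)) → ℝ,
        MvPolynomial.eval x P ≠ 0 →
        Function.Injective
          (fderiv ℝ (cpVec (m := m) (r := r) (N := fun i => N ((i : ℕ) + 1))) x) := by
  obtain ⟨k, rfl⟩ : ∃ k, m = k + 1 := ⟨m - 1, by omega⟩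
  have h0 : 0 < (fun i : Fin (k + 1) => N ((i : ℕ) + 1)) 0 := by
    have := hmono 1 (k + 1) le_rfl (by omega) le_rfl
    change 0 < N (0 + 1)
    rw [zero_add]
    omega
  exact final_gen (fun i : Fin (k + 1) => N ((i : ℕ) + 1)) h0
    (main_ind (k + 1) N hmono hlast k (by omega) le_rfl (fun i : Fin (k + 1) => N ((i : ℕ) + 1))
      (fun i => by change N _ = N _; congr 1; omega) h0 r hr)
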